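/- arXiv:2312.03614 — 2 statements merged into one kernel-verified Lean document; each statement's English description precedes it below -/
import Mathlib

section
/- Lower bound for the average of an affine function over a subset of a ball: For every real number p ≥ 1 there exists a constant C ≥ 1, depending only on N and p, such that for every c ∈ ℝ, every v ∈ ℝ^N, every R > 0 and every Borel set E ⊂ B(0,R) ⊂ ℝ^N with |E| > 0: ⨍_E |c + v·x|^p dx ≥ C⁻¹ (|c|^p + R^p |v|^p) (|E| / R^N)^p, where |E| denotes the Lebesgue measure of E and ⨍ the average integral. -/
open MeasureTheory Metric Set Filter Topology Matrix
open scoped ENNReal NNReal RealInnerProductSpace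

noncomputable section

namespace Griffith

abbrev Euc (N : ℕ) := EuclideanSpace ℝ (Fin N)
abbrev Mat (N : ℕ) := Matrix (Fin N) (Fin N) ℝ

variable {N : ℕ}

/-- Frobenius inner product of two matrices. -/
def frob (ξ η : Mat N) : ℝ := ∑ i, ∑ j, ξ i j * η i j

/-- Frobenius norm of a matrix. -/
def frobNorm (ξ : Mat N) : ℝ := Real.sqrt (frob ξ ξ)

/-- Euclidean norm of a plain vector. -/
def vecNorm (w : Fin N → ℝ) : ℝ := Real.sqrt (∑ i, w i ^ 2)

/-- Real inner product on `ℝ^N`. -/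
def rInner (x y : Euc N) : ℝ := @inner ℝ _ _ x y

/-- The gradient matrix `(∇u)_{ij} = ∂_j u_i` of `u` at `x`. -/
def gradm (u : Euc N → Euc N) (x : Euc N) : Mat N :=
  fun i j => fderiv ℝ u x (EuclideanSpace.single j (1 : ℝ)) i

/-- The symmetrized gradient `e(u) = (∇u + ∇uᵀ)/2`. -/
def eSym (u : Euc N → Euc N) (x : Euc N) : Mat N :=
  (1 / 2 : ℝ) • (gradm u x + (gradm u x)ᵀ)

/-- The hypotheses on the elasticity tensor `𝓒`. -/
structure IsElasticityTensor (𝓒 : Mat N →ₗ[ℝ] Mat N) (c₀ : ℝ) : Prop where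
  one_le : 1 ≤ c₀
  symm : ∀ ξ η : Mat N, frob (𝓒 ξ) η = frob ξ (𝓒 η)
  skew_vanish : ∀ ξ : Mat N, 𝓒 (ξ - ξᵀ) = 0
  coercive : ∀ ξ : Mat N, c₀⁻¹ * frobNorm (ξ + ξᵀ) ^ 2 ≤ frob (𝓒 ξ) ξ

/-- `(N-1)`-dimensional Hausdorff measure on `ℝ^N`. -/
def Hm (N : ℕ) : Measure (Euc N) := μH[(N : ℝ) - 1]

/-- `K` is relatively closed in `Ω`. -/
def RelClosedIn (K Ω : Set (Euc N)) : Prop := K ⊆ Ω ∧ closure K ∩ Ω ⊆ K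

/-- `K` is coral. -/
def Coral (K : Set (Euc N)) : Prop :=
  ∀ x ∈ K, ∀ r : ℝ, 0 < r → 0 < Hm N (K ∩ ball x r)

/-- Admissible pair `(u,K)` in the open set `Ω` : `K` relatively closed
and `u ∈ W^{1,2}_loc(Ω \ K ; ℝ^N)`. -/
structure AdmissiblePair (Ω : Set (Euc N)) (u : Euc N → Euc N) (K : Set (Euc N)) : Prop where
  open_amb : IsOpen Ω
  relClosed : RelClosedIn K Ω
  diffOn : ∀ x ∈ Ω \ K, DifferentiableAt ℝ u x
  locSobolev : ∀ x ∈ Ω \ K, ∃ ε > (0:ℝ), ball x ε ⊆ Ω \ K ∧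
    IntegrableOn (fun y => ‖u y‖ ^ 2 + frobNorm (gradm u y) ^ 2) (ball x ε) volume

/-- Elastic energy `∫_A ℂ e(u) : e(u) dx`. -/
def elastic (𝓒 : Mat N →ₗ[ℝ] Mat N) (u : Euc N → Euc N) (A : Set (Euc N)) : ℝ≥0∞ :=
  ∫⁻ x in A, ENNReal.ofReal (frob (𝓒 (eSym u x)) (eSym u x))

/-- Elastic energy with exponent `p/2` : `∫_A (ℂ e(u) : e(u))^{p/2} dx`. -/
def elasticP (𝓒 : Mat N →ₗ[ℝ] Mat N) (u : Euc N → Euc N) (p : ℝ) (A : Set (Euc N)) : ℝ≥0∞ :=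
  ∫⁻ x in A, ENNReal.ofReal (frob (𝓒 (eSym u x)) (eSym u x)) ^ (p / 2)

/-- The pair `(u,K)` has locally finite energy in `Ω`. -/
def LocFiniteEnergy (Ω : Set (Euc N)) (u : Euc N → Euc N) (K : Set (Euc N)) : Prop :=
  ∀ (x : Euc N) (r : ℝ), 0 < r → closedBall x r ⊆ Ω →
    (∫⁻ y in ball x r \ K, ENNReal.ofReal (frobNorm (eSym u y) ^ 2)) + Hm N (K ∩ ball x r) < ⊤

/-- `(v,L)` is a competitor of `(u,K)` in `B`. -/
structure Competitor (Ω : Set (Euc N)) (u : Euc N → Euc N) (K : Set (Euc N))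
    (B : Set (Euc N)) (v : Euc N → Euc N) (L : Set (Euc N)) : Prop where
  pair : AdmissiblePair Ω v L
  eq_outside : L \ B = K \ B
  ae_eq : ∀ᵐ x ∂volume, x ∈ Ω \ (K ∪ B) → v x = u x

/-- Points of `Ω \ (K ∪ B)` separated by `K` stay separated by `L`. -/
def KeepsSeparation (Ω K B L : Set (Euc N)) : Prop :=
  ∀ x ∈ Ω \ (K ∪ B), ∀ y ∈ Ω \ (K ∪ B),
    y ∉ connectedComponentIn (Ω \ K) x → y ∉ connectedComponentIn (Ω \ L) x

/-- `(v,L)` is a topological competitor of `(u,K)` in `B`. -/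
structure TopCompetitor (Ω : Set (Euc N)) (u : Euc N → Euc N) (K : Set (Euc N))
    (B : Set (Euc N)) (v : Euc N → Euc N) (L : Set (Euc N)) : Prop where
  compet : Competitor Ω u K B v L
  sep : KeepsSeparation Ω K B L

/-- `L` is a topological competitor of the set `K` in `B`. -/
structure TopSetCompetitor (Ω K B L : Set (Euc N)) : Prop where
  relClosed : RelClosedIn L Ω
  eq_outside : L \ B = K \ B
  sep : KeepsSeparation Ω K B L

/-- A gauge. -/
structure IsGauge (h : ℝ → ℝ≥0∞) : Prop where
  mono : ∀ ⦃r s : ℝ⦄, 0 < r → r ≤ s → h r ≤ h s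
  eventually_finite : ∃ r₀ > (0:ℝ), ∀ r : ℝ, 0 < r → r < r₀ → h r ≠ ⊤

/-- Topological Griffith `M`-quasiminimizer with gauge `h` in `Ω`. -/
structure TopQuasiMin (𝓒 : Mat N →ₗ[ℝ] Mat N) (M : ℝ) (Ω : Set (Euc N))
    (u : Euc N → Euc N) (K : Set (Euc N)) (h : ℝ → ℝ≥0∞) : Prop where
  gauge : IsGauge h
  pair : AdmissiblePair Ω u K
  coral : Coral K
  locFin : LocFiniteEnergy Ω u K
  minimality : ∀ (x : Euc N) (r : ℝ), 0 < r → closedBall x r ⊆ Ω →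
    ∀ (v : Euc N → Euc N) (L : Set (Euc N)), TopCompetitor Ω u K (ball x r) v L →
      elastic 𝓒 u (ball x r \ K) + ENNReal.ofReal M⁻¹ * Hm N (K ∩ ball x r) ≤
        elastic 𝓒 v (ball x r \ L) + ENNReal.ofReal M * Hm N (L ∩ ball x r)
          + h r * ENNReal.ofReal (r ^ (N - 1))

/-- Topological Griffith almost-minimizer with gauge `h` in `Ω`. -/
structure TopAlmostMin (𝓒 : Mat N →ₗ[ℝ] Mat N) (Ω : Set (Euc N))
    (u : Euc N → Euc N) (K : Set (Euc N)) (h : ℝ → ℝ≥0∞) : Prop where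
  gauge : IsGauge h
  gauge_zero : Tendsto h (𝓝[>] (0:ℝ)) (𝓝 0)
  pair : AdmissiblePair Ω u K
  coral : Coral K
  locFin : LocFiniteEnergy Ω u K
  minimality : ∀ (x : Euc N) (r : ℝ), 0 < r → closedBall x r ⊆ Ω →
    ∀ (v : Euc N → Euc N) (L : Set (Euc N)), TopCompetitor Ω u K (ball x r) v L →
      elastic 𝓒 u (ball x r \ K) + Hm N (K ∩ ball x r) ≤
        elastic 𝓒 v (ball x r \ L) + Hm N (L ∩ ball x r) + h r * ENNReal.ofReal (r ^ (N - 1))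

/-- Plain Griffith almost-minimizer with gauge `h` in `Ω`. -/
structure AlmostMin (𝓒 : Mat N →ₗ[ℝ] Mat N) (Ω : Set (Euc N))
    (u : Euc N → Euc N) (K : Set (Euc N)) (h : ℝ → ℝ≥0∞) : Prop where
  gauge : IsGauge h
  gauge_zero : Tendsto h (𝓝[>] (0:ℝ)) (𝓝 0)
  pair : AdmissiblePair Ω u K
  coral : Coral K
  locFin : LocFiniteEnergy Ω u K
  minimality : ∀ (x : Euc N) (r : ℝ), 0 < r → closedBall x r ⊆ Ω →
    ∀ (v : Euc N → Euc N) (L : Set (Euc N)), Competitor Ω u K (ball x r) v L →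
      elastic 𝓒 u (ball x r \ K) + Hm N (K ∩ ball x r) ≤
        elastic 𝓒 v (ball x r \ L) + Hm N (L ∩ ball x r) + h r * ENNReal.ofReal (r ^ (N - 1))

/-- Griffith global minimizer in `ℝ^N`. -/
structure GlobalMin (𝓒 : Mat N →ₗ[ℝ] Mat N) (u : Euc N → Euc N) (K : Set (Euc N)) : Prop where
  pair : AdmissiblePair univ u K
  coral : Coral K
  locFin : LocFiniteEnergy univ u K
  minimality : ∀ x ∈ K, ∀ r : ℝ, 0 < r →
    ∀ (v : Euc N → Euc N) (L : Set (Euc N)), TopCompetitor univ u K (ball x r) v L →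
      elastic 𝓒 u (ball x r \ K) + Hm N (K ∩ ball x r) ≤
        elastic 𝓒 v (ball x r \ L) + Hm N (L ∩ ball x r)

/-- Almost-minimal set with gauge `h` in `Ω`. -/
structure AlmostMinimalSet (Ω K : Set (Euc N)) (h : ℝ → ℝ≥0∞) : Prop where
  gauge : IsGauge h
  gauge_zero : Tendsto h (𝓝[>] (0:ℝ)) (𝓝 0)
  relClosed : RelClosedIn K Ω
  coral : Coral K
  minimality : ∀ x ∈ K, ∀ r : ℝ, 0 < r → closedBall x r ⊆ Ω →
    ∀ L : Set (Euc N), TopSetCompetitor Ω K (ball x r) L →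
      Hm N (K ∩ ball x r) ≤ Hm N (L ∩ ball x r) + h r * ENNReal.ofReal (r ^ (N - 1))

/-- Minimal set in `Ω`. -/
structure MinimalSet (Ω K : Set (Euc N)) : Prop where
  relClosed : RelClosedIn K Ω
  coral : Coral K
  minimality : ∀ x ∈ K, ∀ r : ℝ, 0 < r → closedBall x r ⊆ Ω →
    ∀ L : Set (Euc N), TopSetCompetitor Ω K (ball x r) L →
      Hm N (K ∩ ball x r) ≤ Hm N (L ∩ ball x r)

/-- The flatness `β_K(x₀,r₀)`. -/
def flatness (K : Set (Euc N)) (x₀ : Euc N) (r₀ : ℝ) : ℝ :=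
  sInf {t : ℝ | 0 ≤ t ∧ ∃ ν : Euc N, ‖ν‖ = 1 ∧
    ∀ x ∈ K ∩ ball x₀ r₀, |rInner ν (x - x₀)| ≤ t * r₀}

/-- The bilateral flatness `β^bil_K(x₀,r₀)`. -/
def bilFlatness (K : Set (Euc N)) (x₀ : Euc N) (r₀ : ℝ) : ℝ :=
  sInf {t : ℝ | 0 ≤ t ∧ ∃ ν : Euc N, ‖ν‖ = 1 ∧
    (∀ x ∈ K ∩ ball x₀ r₀, |rInner ν (x - x₀)| ≤ t * r₀) ∧
    (∀ y ∈ ball x₀ r₀, rInner ν (y - x₀) = 0 → infDist y K ≤ t * r₀)}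

/-- The unit vector `ν₀` is normal to a hyperplane through `x₀` attaining the flatness. -/
def AttainsFlatness (K : Set (Euc N)) (x₀ : Euc N) (r₀ : ℝ) (ν₀ : Euc N) : Prop :=
  ‖ν₀‖ = 1 ∧ ∀ x ∈ K ∩ ball x₀ r₀, |rInner ν₀ (x - x₀)| ≤ flatness K x₀ r₀ * r₀

/-- The normalized elastic energy `ω_p(x₀,r₀)`. -/
def omegaP (u : Euc N → Euc N) (K : Set (Euc N)) (p : ℝ) (x₀ : Euc N) (r₀ : ℝ) : ℝ≥0∞ :=
  ENNReal.ofReal (r₀ ^ (1 - 2 * (N : ℝ) / p)) *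
    (∫⁻ x in ball x₀ r₀ \ K, ENNReal.ofReal (frobNorm (eSym u x) ^ p)) ^ (2 / p)

/-- `ω_{N-1}`, the Lebesgue measure of the `(N-1)`-dimensional unit disk. -/
def unitDiskVol (N : ℕ) : ℝ≥0∞ := volume (ball (0 : EuclideanSpace ℝ (Fin (N - 1))) 1)

/-- The ball `D₁ = B(x₀ + (3r₀/4)ν₀, r₀/8)`. -/
def Dplus (x₀ : Euc N) (r₀ : ℝ) (ν₀ : Euc N) : Set (Euc N) :=
  ball (x₀ + (3 * r₀ / 4) • ν₀) (r₀ / 8)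

/-- The ball `D₂ = B(x₀ - (3r₀/4)ν₀, r₀/8)`. -/
def Dminus (x₀ : Euc N) (r₀ : ℝ) (ν₀ : Euc N) : Set (Euc N) :=
  ball (x₀ - (3 * r₀ / 4) • ν₀) (r₀ / 8)

/-- `b_i = ⨍_{D_i} u`. -/
def avgDisp (u : Euc N → Euc N) (D : Set (Euc N)) : Euc N := ⨍ y in D, u y

/-- `A_i = ⨍_{D_i} (∇u - ∇uᵀ)/2`. -/
def avgRot (u : Euc N → Euc N) (D : Set (Euc N)) : Mat N :=
  fun i j => ⨍ y in D, (gradm u y i j - gradm u y j i) / 2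

/-- The normalized jump `J(x₀,r₀)` (relative to an optimal normal direction `ν₀`). -/
def normJump (u : Euc N → Euc N) (x₀ : Euc N) (r₀ : ℝ) (ν₀ : Euc N) : ℝ :=
  (‖avgDisp u (Dplus x₀ r₀ ν₀) - avgDisp u (Dminus x₀ r₀ ν₀)‖ +
    r₀ * frobNorm (avgRot u (Dplus x₀ r₀ ν₀) - avgRot u (Dminus x₀ r₀ ν₀))) / Real.sqrt r₀

/-- The component `J(ν)` of the jump in the direction `ν`. -/
def dirJump (u : Euc N → Euc N) (x₀ : Euc N) (r₀ : ℝ) (ν₀ ν : Euc N) : ℝ :=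
  (|rInner (avgDisp u (Dplus x₀ r₀ ν₀) - avgDisp u (Dminus x₀ r₀ ν₀)) ν| +
    r₀ * vecNorm ((avgRot u (Dplus x₀ r₀ ν₀) - avgRot u (Dminus x₀ r₀ ν₀)).mulVec
      (fun j => ν j))) / Real.sqrt r₀

/-- Orthogonal projection onto the hyperplane `x₀ + ν^⊥`. -/
def projHyp (x₀ ν : Euc N) (y : Euc N) : Euc N := y - (rInner ν (y - x₀)) • ν

/-- The set of holes `S(x₀,r₀,ν,ε)` through slicing in the direction `ν`. -/
def slicedHoles (K : Set (Euc N)) (x₀ : Euc N) (r₀ : ℝ) (ν : Euc N) (ε : ℝ) : Set (Euc N) :=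
  ({y : Euc N | rInner ν (y - x₀) = 0} ∩ ball x₀ ((1 - 4 * ε) * r₀)) \
    (projHyp x₀ ν '' (K ∩ ball x₀ r₀))

/-- Rigid motion: `x ↦ b + Ax` with `A` skew-symmetric. -/
def IsRigidMotion (a : Euc N → Euc N) : Prop :=
  ∃ (b : Euc N) (A : Euc N →ₗ[ℝ] Euc N),
    (∀ x y : Euc N, rInner (A x) y = - rInner x (A y)) ∧ ∀ x, a x = b + A x

/-- Every compact subset of `Ω` is contained in `Ωs i` for all large `i`. -/
def ExhaustsCompacts (Ωs : ℕ → Set (Euc N)) (Ω : Set (Euc N)) : Prop :=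
  ∀ H : Set (Euc N), IsCompact H → H ⊆ Ω → ∀ᶠ i in atTop, H ⊆ Ωs i

/-- Local Hausdorff convergence of `Ks i` towards `K` inside `Ω`. -/
def LocalHausdorffConv (Ω : Set (Euc N)) (Ks : ℕ → Set (Euc N)) (K : Set (Euc N)) : Prop :=
  ∀ H : Set (Euc N), IsCompact H → H ⊆ Ω →
    Tendsto (fun i => (⨆ x ∈ Ks i ∩ H, EMetric.infEdist x K) +
      ⨆ x ∈ K ∩ H, EMetric.infEdist x (Ks i)) atTop (𝓝 0)

/-- Convergence of the pairs `(us i, Ks i)` towards the pair `(u,K)` in `Ω`. -/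
def PairsConv (Ω : Set (Euc N)) (us : ℕ → Euc N → Euc N) (Ks : ℕ → Set (Euc N))
    (u : Euc N → Euc N) (K : Set (Euc N)) : Prop :=
  RelClosedIn K Ω ∧ LocalHausdorffConv Ω Ks K ∧
  ∀ z ∈ Ω \ K, ∃ a : ℕ → Euc N → Euc N, (∀ i, IsRigidMotion (a i)) ∧
    ∀ H : Set (Euc N), IsCompact H → H ⊆ connectedComponentIn (Ω \ K) z →
      Tendsto (fun i => ∫ x in H, ‖us i x - a i x - u x‖ ^ 2) atTop (𝓝 (0 : ℝ))

/-- `h⁺(r) = lim_{t → r⁺} limsup_i hs i t` (for nondecreasing gauges, the right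
limit is the infimum over `t > r`). -/
def limsupGauge (hs : ℕ → ℝ → ℝ≥0∞) (r : ℝ) : ℝ≥0∞ :=
  ⨅ t ∈ Ioi r, Filter.limsup (fun i => hs i t) atTop

open Classical in
/-- The limit gauge, truncated at the threshold `ε'`. -/
def limitGauge (hs : ℕ → ℝ → ℝ≥0∞) (ε' : ℝ) (r : ℝ) : ℝ≥0∞ :=
  if limsupGauge hs r < ENNReal.ofReal ε' then limsupGauge hs r else ⊤

/-- `x` is a regular point of `K`. -/
def RegularPoint (K : Set (Euc N)) (x : Euc N) : Prop :=
  ∃ r : ℕ → ℝ, (∀ i, 0 < r i) ∧ Tendsto r atTop (𝓝 (0:ℝ)) ∧ ∃ ν : Euc N, ‖ν‖ = 1 ∧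
    Tendsto (fun i =>
      (ENNReal.ofReal (r i))⁻¹ *
        ((⨆ y ∈ {z : Euc N | rInner ν (z - x) = 0} ∩ ball x (r i), EMetric.infEdist y K) +
          ⨆ y ∈ K ∩ ball x (r i), EMetric.infEdist y {z : Euc N | rInner ν (z - x) = 0}))
      atTop (𝓝 0)

/-- The singular part of `K`. -/
def singularPart (K : Set (Euc N)) : Set (Euc N) := {x ∈ K | ¬ RegularPoint K x}


/-- Measure of a strip intersected with a ball, by disjoint translations. -/
theorem strip_bound (N : ℕ) (c : ℝ) (v : Euc N) (hv : v ≠ 0) (R t : ℝ) (hR : 0 < R)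
    (ht : 0 < t) :
    volume.real {x : Euc N | x ∈ ball (0 : Euc N) R ∧ |c + rInner v x| < t} * (R * ‖v‖) ≤
      2 * t * ((2 * R) ^ N * volume.real (ball (0 : Euc N) 1)) := by
  set S := {x : Euc N | x ∈ ball (0 : Euc N) R ∧ |c + rInner v x| < t} with hS
  have hvn : 0 < ‖v‖ := norm_pos_iff.mpr hv
  have hcont : Continuous fun x : Euc N => |c + rInner v x| := by
    unfold rInner; fun_prop
  have hSm : MeasurableSet S :=
    (isOpen_ball.inter (isOpen_lt hcont continuous_const)).measurableSet
  set w : Euc N := (2 * t / ‖v‖ ^ 2) • v with hw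
  have hvw : rInner v w = 2 * t := by
    simp only [rInner, hw, inner_smul_right, real_inner_self_eq_norm_sq]
    field_simp
  have hwn : ‖w‖ = 2 * t / ‖v‖ := by
    rw [hw, norm_smul, Real.norm_of_nonneg (by positivity)]
    field_simp
  set n := ⌈R * ‖v‖ / (2 * t)⌉₊ with hn
  let T : ℕ → Set (Euc N) := fun k => (fun x => x + (-((k : ℝ) • w))) ⁻¹' S
  have hTm : ∀ k, MeasurableSet (T k) := fun k =>
    (measurable_id.add_const _) hSm
  have hTv : ∀ k, volume.real (T k) = volume.real S := fun k => by
    simp only [Measure.real, T, measure_preimage_add_right]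
  have hf : ∀ (x : Euc N) (k : ℕ), rInner v (x + (-((k : ℝ) • w))) = rInner v x - k * (2 * t) := by
    intro x k
    rw [← hvw]
    simp only [rInner, inner_add_right, inner_neg_right, inner_smul_right]
    ring
  have hdisj : Set.PairwiseDisjoint (↑(Finset.range n)) T := by
    intro k _ j _ hkj
    refine Set.disjoint_left.mpr ?_
    rintro x ⟨_, hk⟩ ⟨_, hj⟩
    rw [hf, abs_lt] at hk hj
    apply hkj
    have h1 : ((k : ℝ) - j) < 1 := by
      by_contra! h
      nlinarith
    have h2 : ((j : ℝ) - k) < 1 := by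
      by_contra! h
      nlinarith
    have h3 : (k : ℝ) < j + 1 := by linarith
    have h4 : (j : ℝ) < k + 1 := by linarith
    norm_cast at h3 h4
    omega
  have hsub : (⋃ k ∈ Finset.range n, T k) ⊆ ball (0 : Euc N) (2 * R) := by
    intro x hx
    simp only [Set.mem_iUnion, Finset.mem_range] at hx
    obtain ⟨k, hk, hxS, _⟩ := hx
    have hk' : (k : ℝ) < R * ‖v‖ / (2 * t) := Nat.lt_ceil.mp hk
    rw [mem_ball_zero_iff] at hxS ⊢
    have h5 : ‖(k : ℝ) • w‖ < R := by
      rw [norm_smul, hwn, Real.norm_of_nonneg (by positivity)]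
      rw [lt_div_iff₀ (by positivity)] at hk'
      rw [mul_div_assoc', div_lt_iff₀ hvn]
      exact hk'
    calc ‖x‖ = ‖(x + (-((k : ℝ) • w))) + (k : ℝ) • w‖ := by congr 1; abel
      _ ≤ _ := norm_add_le _ _
      _ < 2 * R := by linarith
  have hmeas : n * volume.real S ≤ volume.real (ball (0 : Euc N) (2 * R)) := by
    have h1 := measureReal_biUnion_finset (μ := volume) hdisj (fun k _ => hTm k)
      (fun k _ => by
        simp only [T, measure_preimage_add_right]
        exact ((measure_mono (fun x hx => hx.1)).trans_lt
          (measure_ball_lt_top (x := (0 : Euc N)) (r := R))).ne)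
    simp only [hTv, Finset.sum_const, Finset.card_range, nsmul_eq_mul] at h1
    rw [← h1]
    exact measureReal_mono hsub measure_ball_lt_top.ne
  have hball : volume.real (ball (0 : Euc N) (2 * R)) =
      (2 * R) ^ N * volume.real (ball (0 : Euc N) 1) := by
    rw [Measure.real, Measure.addHaar_ball_of_pos _ _ (by positivity), ENNReal.toReal_mul,
      ENNReal.toReal_ofReal (by positivity), finrank_euclideanSpace_fin, Measure.real]
  rw [hball] at hmeas
  have hn' : R * ‖v‖ / (2 * t) ≤ n := Nat.le_ceil _
  rw [div_le_iff₀ (by positivity)] at hn'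
  have hS0 : 0 ≤ volume.real S := measureReal_nonneg
  calc volume.real S * (R * ‖v‖) ≤ volume.real S * (n * (2 * t)) := by gcongr
    _ = 2 * t * (n * volume.real S) := by ring
    _ ≤ _ := by gcongr

/-- Sublevel set estimate. -/
theorem sublevel_bound (N : ℕ) (c : ℝ) (v : Euc N) (R t : ℝ) (hR : 0 < R) (ht : 0 < t) :
    volume.real {x : Euc N | x ∈ ball (0 : Euc N) R ∧ |c + rInner v x| < t} *
        max |c| (R * ‖v‖) ≤
      (2 ^ (N + 2) * volume.real (ball (0 : Euc N) 1)) * R ^ N * t := by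
  set S := {x : Euc N | x ∈ ball (0 : Euc N) R ∧ |c + rInner v x| < t} with hS
  have hS0 : 0 ≤ volume.real S := measureReal_nonneg
  set ω := volume.real (ball (0 : Euc N) 1)
  have hω : 0 ≤ ω := measureReal_nonneg
  have hv0 := norm_nonneg v
  by_cases hcase : 2 * (R * ‖v‖) ≤ |c|
  · have hM : max |c| (R * ‖v‖) = |c| := max_eq_left (by nlinarith [mul_nonneg hR.le hv0])
    rw [hM]
    by_cases hne : S.Nonempty
    · obtain ⟨x, hx, hxt⟩ := hne
      rw [mem_ball_zero_iff] at hx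
      have h1 : |rInner v x| ≤ ‖v‖ * ‖x‖ := abs_real_inner_le_norm v x
      have h2 : ‖v‖ * ‖x‖ ≤ R * ‖v‖ := by nlinarith
      have h3 : |c| ≤ |c + rInner v x| + |rInner v x| := by
        have := abs_sub (c + rInner v x) (rInner v x)
        simpa using this
      have h4 : |c| ≤ 2 * t := by linarith
      have h5 : volume.real S ≤ R ^ N * ω := by
        have : volume.real (ball (0 : Euc N) R) = R ^ N * ω := by
          rw [Measure.real, Measure.addHaar_ball_of_pos _ _ (by positivity), ENNReal.toReal_mul,
            ENNReal.toReal_ofReal (by positivity), finrank_euclideanSpace_fin]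
          rfl
        rw [← this]
        exact measureReal_mono (fun x hx => hx.1) measure_ball_lt_top.ne
      have h6 : (1 : ℝ) ≤ 2 ^ N := one_le_pow₀ (by norm_num)
      have h7 : 0 ≤ R ^ N * ω * t := by positivity
      calc volume.real S * |c| ≤ (R ^ N * ω) * (2 * t) := by gcongr
        _ ≤ _ := by rw [pow_add]; nlinarith
    · rw [Set.not_nonempty_iff_eq_empty.mp hne]
      simp only [measureReal_empty, zero_mul]
      positivity
  · push Not at hcase
    have hv : v ≠ 0 := by
      rintro rfl
      simp only [norm_zero, mul_zero] at hcase
      exact absurd hcase (not_lt.mpr (abs_nonneg c))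
    have hM : max |c| (R * ‖v‖) ≤ 2 * (R * ‖v‖) :=
      max_le hcase.le (by nlinarith [mul_nonneg hR.le hv0])
    have := strip_bound N c v hv R t hR ht
    calc volume.real S * max |c| (R * ‖v‖) ≤ volume.real S * (2 * (R * ‖v‖)) := by gcongr
      _ = 2 * (volume.real S * (R * ‖v‖)) := by ring
      _ ≤ 2 * (2 * t * ((2 * R) ^ N * ω)) := by gcongr
      _ = _ := by rw [mul_pow, pow_add]; ring

/-- Lower bound for the average of an affine function over a
subset of a ball. -/
theorem affine_average_lower_bound
    (N : ℕ) (hN : 1 ≤ N) (p : ℝ) (hp : 1 ≤ p) :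
    ∃ C : ℝ, 1 ≤ C ∧
      ∀ (c : ℝ) (v : Euc N) (R : ℝ), 0 < R →
        ∀ E : Set (Euc N), MeasurableSet E → E ⊆ ball (0 : Euc N) R →
          0 < volume E →
          C⁻¹ * ((|c| ^ p + R ^ p * ‖v‖ ^ p) * ((volume E).toReal / R ^ N) ^ p) ≤
            ⨍ x in E, |c + rInner v x| ^ p := by
  set ω := volume.real (ball (0 : Euc N) 1) with hωdef
  have hω : 0 < ω := ENNReal.toReal_pos (measure_ball_pos _ _ one_pos).ne' measure_ball_lt_top.ne
  set K : ℝ := 2 ^ (N + 2) * ω with hK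
  have hK0 : 0 < K := by positivity
  have hp0 : 0 < p := by linarith
  refine ⟨max 1 (4 * (2 * K) ^ p), le_max_left _ _, ?_⟩
  intro c v R hR E hE hER hE0
  have hEfin : volume E ≠ ⊤ := ((measure_mono hER).trans_lt measure_ball_lt_top).ne
  set m := volume.real E with hm
  have hm0 : 0 < m := ENNReal.toReal_pos hE0.ne' hEfin
  change _ * (_ * (m / R ^ N) ^ p) ≤ _
  have hcont : Continuous fun x : Euc N => |c + rInner v x| := by
    unfold rInner; fun_prop
  have hcontp : Continuous fun x : Euc N => |c + rInner v x| ^ p :=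
    hcont.rpow_const (fun _ => Or.inr hp0.le)
  have hint : IntegrableOn (fun x : Euc N => |c + rInner v x| ^ p) E := by
    apply IntegrableOn.mono_set _ (hER.trans ball_subset_closedBall)
    exact hcontp.continuousOn.integrableOn_compact (isCompact_closedBall _ _)
  have hnonneg : ∀ x : Euc N, 0 ≤ |c + rInner v x| ^ p := fun x => by positivity
  rw [setAverage_eq, smul_eq_mul]
  set M := max |c| (R * ‖v‖) with hM
  have hM0 : 0 ≤ M := le_max_of_le_left (abs_nonneg c)
  have hsum : |c| ^ p + R ^ p * ‖v‖ ^ p ≤ 2 * M ^ p := by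
    rw [← Real.mul_rpow hR.le (norm_nonneg v)]
    have h1 : |c| ^ p ≤ M ^ p := Real.rpow_le_rpow (abs_nonneg c) (le_max_left _ _) hp0.le
    have h2 : (R * ‖v‖) ^ p ≤ M ^ p :=
      Real.rpow_le_rpow (by positivity) (le_max_right _ _) hp0.le
    linarith
  rcases hM0.eq_or_lt with hMz | hMpos
  · rw [← hMz, Real.zero_rpow hp0.ne', mul_zero] at hsum
    have hz : |c| ^ p + R ^ p * ‖v‖ ^ p = 0 := le_antisymm hsum (by positivity)
    rw [hz, zero_mul, mul_zero]
    exact mul_nonneg (inv_nonneg.mpr measureReal_nonneg) (integral_nonneg hnonneg)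
  set t := m * M / (2 * K * R ^ N) with ht
  have ht0 : 0 < t := by positivity
  have hsub := sublevel_bound N c v R t hR ht0
  set S := {x : Euc N | x ∈ ball (0 : Euc N) R ∧ |c + rInner v x| < t} with hS
  have hSfin : volume S ≠ ⊤ :=
    ((measure_mono (fun x hx => hx.1)).trans_lt
      (measure_ball_lt_top (x := (0 : Euc N)) (r := R))).ne
  have hSle : volume.real S ≤ m / 2 := by
    have h1 : K * R ^ N * t = m / 2 * M := by rw [ht]; field_simp
    change volume.real S * M ≤ K * R ^ N * t at hsub
    rw [h1] at hsub
    exact le_of_mul_le_mul_right hsub hMpos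
  have hdiff : m / 2 ≤ volume.real (E \ S) := by
    have := measureReal_mono (μ := volume) (s₁ := E) (s₂ := (E \ S) ∪ S)
      (by intro x hx; by_cases h : x ∈ S <;> simp [hx, h])
      (measure_union_lt_top ((measure_mono diff_subset).trans_lt hEfin.lt_top) hSfin.lt_top).ne
    have h2 := measureReal_union_le (μ := volume) (E \ S) S
    linarith
  have hSm : MeasurableSet S :=
    (isOpen_ball.inter (isOpen_lt hcont continuous_const)).measurableSet
  have hintlow : t ^ p * (m / 2) ≤ ∫ x in E, |c + rInner v x| ^ p := by
    calc t ^ p * (m / 2) ≤ t ^ p * volume.real (E \ S) := by gcongr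
      _ ≤ ∫ x in E \ S, |c + rInner v x| ^ p := by
        apply setIntegral_ge_of_const_le_real (hE.diff hSm)
          ((measure_mono diff_subset).trans_lt hEfin.lt_top).ne _ (hint.mono_set diff_subset)
        intro x hx
        have : t ≤ |c + rInner v x| := by
          by_contra! h
          exact hx.2 ⟨hER hx.1, h⟩
        exact Real.rpow_le_rpow ht0.le this hp0.le
      _ ≤ _ := setIntegral_mono_set hint (Eventually.of_forall hnonneg)
        diff_subset.eventuallyLE
  have htp : t ^ p = M ^ p * (m / R ^ N) ^ p / (2 * K) ^ p := by
    rw [← Real.mul_rpow hM0 (by positivity), ← Real.div_rpow (by positivity) (by positivity), ht]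
    congr 1
    field_simp
  have hKp : 0 < (2 * K) ^ p := by positivity
  calc (max 1 (4 * (2 * K) ^ p))⁻¹ * ((|c| ^ p + R ^ p * ‖v‖ ^ p) * (m / R ^ N) ^ p)
      ≤ (4 * (2 * K) ^ p)⁻¹ * ((2 * M ^ p) * (m / R ^ N) ^ p) := by
        gcongr
        exact le_max_right _ _
    _ = m⁻¹ * (t ^ p * (m / 2)) := by rw [htp]; field_simp; norm_num
    _ ≤ _ := by gcongr

end Griffith
end
end

section
/- Lower bound for the average of a rigid-motion norm over a subset of the unit sphere: For every real number p ≥ 1 there exists a constant C ≥ 1, depending only on N and p, such that for every Borel set E ⊂ ∂B(0,1) ⊂ ℝ^N with H^{N−1}(E) > 0, every vector b ∈ ℝ^N, and every matrix A ∈ ℝ^{N×N}: ⨍_E (|b·x|^p + |Ax|^p) dH^{N−1}(x) ≥ C⁻¹ (|b|^p + |A|^p) H^{N−1}(E)^p. -/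
open MeasureTheory Metric Set Filter Topology Matrix
open scoped ENNReal NNReal RealInnerProductSpace

noncomputable section

namespace Griffith

variable {N : ℕ}

lemma hausdorff_le_of_anti {X Y : Type*} [MetricSpace X] [MeasurableSpace X] [BorelSpace X]
    [MetricSpace Y] [MeasurableSpace Y] [BorelSpace Y] (f : X → Y) (P : Set X) (K : ℝ≥0)
    (h : ∀ x ∈ P, ∀ y ∈ P, dist x y ≤ K * dist (f x) (f y)) {d : ℝ} (hd : 0 ≤ d) :
    μH[d] P ≤ (K : ℝ≥0∞) ^ d * μH[d] (f '' P) := by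
  have ha : AntilipschitzWith K (fun x : P => f x) :=
    AntilipschitzWith.of_le_mul_dist (fun x y => h x x.2 y y.2)
  have h1 := ha.le_hausdorffMeasure_image hd univ
  have h2 := (isometry_subtype_coe (s := P)).hausdorffMeasure_image (d := d) (Or.inl hd) univ
  rw [← h2] at h1
  have h3 : (fun x : P => f x) '' univ = f '' P := by
    ext y; simp
  rw [h3] at h1
  simpa using h1

/-- bi-Lipschitz estimate of the projection of a cap. -/
lemma cap_anti (N : ℕ) (hN : 2 ≤ N) (B : OrthonormalBasis (Fin N) ℝ (Euc N))
    (j : Fin N) (s : ℝ) (hs : s = 1 ∨ s = -1) (x y : Euc N) (hx : ‖x‖ = 1) (hy : ‖y‖ = 1)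
    (hxj : 1 / (2 * (N : ℝ)) ≤ s * inner ℝ (B j) x)
    (hyj : 1 / (2 * (N : ℝ)) ≤ s * inner ℝ (B j) y) (D : ℝ)
    (hD : ∀ i, i ≠ j → |inner ℝ (B i) x - inner ℝ (B i) y| ≤ D) (hD0 : 0 ≤ D) :
    dist x y ≤ (N * (1 + 2 * N)) * D := by
  have hN0 : (0 : ℝ) < N := by positivity
  have hle : ∀ z : Euc N, ‖z‖ = 1 → ∀ i, |inner ℝ (B i) z| ≤ 1 := by
    intro z hz i
    have := abs_real_inner_le_norm (B i) z
    simpa [hz] using this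
  have hsum : ∀ z : Euc N, ‖z‖ = 1 →
      (inner ℝ (B j) z) ^ 2 + ∑ i ∈ Finset.univ.erase j, (inner ℝ (B i) z) ^ 2 = 1 := by
    intro z hz
    rw [Finset.add_sum_erase _ (fun i => (inner ℝ (B i) z) ^ 2) (Finset.mem_univ j),
      B.sum_sq_inner_right, hz]; norm_num
  have hcard : ((Finset.univ.erase j : Finset (Fin N)).card : ℝ) ≤ N := by
    have := Finset.card_le_univ (Finset.univ.erase j : Finset (Fin N))
    simp only [Fintype.card_fin] at this
    exact_mod_cast this
  have h1 : ∑ i ∈ Finset.univ.erase j, |inner ℝ (B i) x - inner ℝ (B i) y| ≤ N * D := by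
    calc _ ≤ ∑ i ∈ Finset.univ.erase j, D :=
          Finset.sum_le_sum (fun i hi => hD i (Finset.ne_of_mem_erase hi))
      _ = (Finset.univ.erase j : Finset (Fin N)).card * D := by simp
      _ ≤ N * D := by gcongr
  have h2 : |(inner ℝ (B j) x) ^ 2 - (inner ℝ (B j) y) ^ 2| ≤ 2 * (N * D) := by
    have e : (inner ℝ (B j) x) ^ 2 - (inner ℝ (B j) y) ^ 2 =
        ∑ i ∈ Finset.univ.erase j, ((inner ℝ (B i) y) ^ 2 - (inner ℝ (B i) x) ^ 2) := by
      rw [Finset.sum_sub_distrib]; linarith [hsum x hx, hsum y hy]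
    rw [e]
    calc _ ≤ ∑ i ∈ Finset.univ.erase j, |(inner ℝ (B i) y) ^ 2 - (inner ℝ (B i) x) ^ 2| :=
          Finset.abs_sum_le_sum_abs _ _
      _ ≤ ∑ i ∈ Finset.univ.erase j, 2 * |inner ℝ (B i) x - inner ℝ (B i) y| := by
          refine Finset.sum_le_sum (fun i _ => ?_)
          rw [sq_sub_sq, abs_mul, abs_sub_comm (inner ℝ (B i) y)]
          refine mul_le_mul_of_nonneg_right ?_ (abs_nonneg _)
          exact (abs_add_le _ _).trans (by linarith [hle x hx i, hle y hy i])
      _ ≤ _ := by rw [← Finset.mul_sum]; linarith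
  have h3 : |inner ℝ (B j) x - inner ℝ (B j) y| ≤ 2 * N * (N * D) := by
    rw [sq_sub_sq, abs_mul] at h2
    have h4 : 1 / (N : ℝ) ≤ |inner ℝ (B j) x + inner ℝ (B j) y| := by
      have : 1 / (N : ℝ) ≤ s * (inner ℝ (B j) x + inner ℝ (B j) y) := by
        have : 1 / (N : ℝ) = 1 / (2 * (N : ℝ)) + 1 / (2 * (N : ℝ)) := by field_simp; norm_num
        rw [mul_add, this]; linarith
      refine this.trans ?_
      rcases hs with rfl | rfl
      · simpa using le_abs_self _
      · simpa [add_comm] using neg_le_abs (inner ℝ (B j) x + inner ℝ (B j) y)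
    have h5 := (mul_le_mul_of_nonneg_right h4
      (abs_nonneg (inner ℝ (B j) x - inner ℝ (B j) y))).trans h2
    rw [div_mul_eq_mul_div, one_mul, div_le_iff₀ hN0] at h5
    linarith
  have h6 : dist x y ≤ ∑ i, |inner ℝ (B i) x - inner ℝ (B i) y| := by
    rw [dist_eq_norm]
    conv_lhs => rw [← B.sum_repr' (x - y)]
    refine (norm_sum_le _ _).trans (Finset.sum_le_sum (fun i _ => ?_))
    rw [norm_smul, inner_sub_right]; simp
  rw [← Finset.add_sum_erase _ _ (Finset.mem_univ j)] at h6
  linarith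

lemma piece_bound (N : ℕ) (hN : 2 ≤ N) (B : OrthonormalBasis (Fin N) ℝ (Euc N))
    (k j : Fin N) (s : ℝ) (hs : s = 1 ∨ s = -1) (t : ℝ) (ht : 0 < t) :
    Hm N {x | ‖x‖ = 1 ∧ |inner ℝ (B k) x| ≤ t ∧ 1 / (2 * (N : ℝ)) ≤ s * inner ℝ (B j) x} ≤
      (((N : ℝ≥0) * (1 + 2 * N) : ℝ≥0) : ℝ≥0∞) ^ ((N : ℝ) - 1) *
        ENNReal.ofReal (2 ^ N * N * t) := by
  set P : Set (Euc N) :=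
    {x | ‖x‖ = 1 ∧ |inner ℝ (B k) x| ≤ t ∧ 1 / (2 * (N : ℝ)) ≤ s * inner ℝ (B j) x} with hP
  have hN2 : (2 : ℝ) ≤ N := by exact_mod_cast hN
  have hle : ∀ z : Euc N, ‖z‖ = 1 → ∀ i, |inner ℝ (B i) z| ≤ 1 := by
    intro z hz i
    have := abs_real_inner_le_norm (B i) z
    simpa [hz] using this
  rcases P.eq_empty_or_nonempty with h0 | ⟨x0, hx0⟩
  · rw [h0]; simp
  let f : Euc N → ({i : Fin N // i ≠ j} → ℝ) := fun x i => inner ℝ (B i) x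
  have h1 := hausdorff_le_of_anti f P ((N : ℝ≥0) * (1 + 2 * N)) (by
    intro x hx y hy
    have := cap_anti N hN B j s hs x y hx.1 hy.1 hx.2.2 hy.2.2 (dist (f x) (f y)) (by
      intro i hi
      have := dist_le_pi_dist (f x) (f y) ⟨i, hi⟩
      simpa [Real.dist_eq, f] using this) dist_nonneg
    simpa using this) (d := (N : ℝ) - 1) (by linarith)
  refine h1.trans ?_
  gcongr
  let r : {i : Fin N // i ≠ j} → ℝ := fun i => if (i : Fin N) = k then t else 1
  have hsub : f '' P ⊆ Icc (-r) r := by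
    rintro _ ⟨x, hx, rfl⟩
    have : ∀ i, |f x i| ≤ r i := by
      intro i
      by_cases h : (i : Fin N) = k
      · simp only [r, f, h, if_true]; exact hx.2.1
      · simp only [r, f, h, if_false]; exact hle x hx.1 i
    exact ⟨fun i => (abs_le.1 (this i)).1, fun i => (abs_le.1 (this i)).2⟩
  have hcard : Fintype.card {i : Fin N // i ≠ j} = N - 1 := by simp
  have hdim : ((N : ℝ) - 1) = (Fintype.card {i : Fin N // i ≠ j} : ℝ) := by
    rw [hcard, Nat.cast_sub (by omega)]; simp
  rw [hdim, hausdorffMeasure_pi_real]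
  refine (measure_mono hsub).trans ?_
  rw [Real.volume_Icc_pi, ← ENNReal.ofReal_prod_of_nonneg (by
    intro i _; simp only [r, Pi.neg_apply]; split_ifs <;> linarith)]
  refine ENNReal.ofReal_le_ofReal ?_
  have e1 : ∏ i, (r i - (-r) i) = 2 ^ (N - 1) * ∏ i, r i := by
    rw [← hcard, ← Finset.card_univ, ← Finset.prod_const, ← Finset.prod_mul_distrib]
    refine Finset.prod_congr rfl (fun i _ => ?_)
    simp; ring
  have e2 : (2 : ℝ) ^ N = 2 ^ (N - 1) * 2 := by
    rw [← pow_succ]; congr 1; omega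
  rw [e1, e2, mul_assoc, mul_assoc]
  refine mul_le_mul_of_nonneg_left ?_ (by positivity)
  by_cases hkj : k = j
  · have : ∏ i, r i = 1 := by
      refine Finset.prod_eq_one (fun i _ => ?_)
      simp only [r]; rw [if_neg]; rw [hkj]; exact i.2
    rw [this]
    have h2 : 1 / (2 * (N : ℝ)) ≤ t := by
      refine hx0.2.2.trans (le_trans ?_ hx0.2.1)
      rw [hkj]
      rcases hs with rfl | rfl
      · simpa using le_abs_self _
      · simpa using neg_le_abs (inner ℝ (B j) x0)
    rw [div_le_iff₀ (by positivity)] at h2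
    linarith
  · have : ∏ i, r i = t := by
      rw [Finset.prod_eq_single (⟨k, hkj⟩ : {i : Fin N // i ≠ j})]
      · simp [r]
      · intro i _ hi
        simp only [r]; rw [if_neg]; intro h; exact hi (Subtype.ext h)
      · simp
    rw [this]; nlinarith

lemma band_bound (N : ℕ) (hN : 2 ≤ N) : ∃ K : ℝ, 1 ≤ K ∧ ∀ ν : Euc N, ‖ν‖ = 1 → ∀ t : ℝ, 0 < t →
    Hm N {x | ‖x‖ = 1 ∧ |inner ℝ ν x| ≤ t} ≤ ENNReal.ofReal (K * t) := by
  have hN2 : (2 : ℝ) ≤ N := by exact_mod_cast hN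
  set M : ℝ≥0∞ := (((N : ℝ≥0) * (1 + 2 * N) : ℝ≥0) : ℝ≥0∞) ^ ((N : ℝ) - 1) with hM
  have hMt : M ≠ ⊤ := ENNReal.rpow_ne_top_of_nonneg (by linarith) ENNReal.coe_ne_top
  refine ⟨max 1 (N * 2 * (M.toReal * (2 ^ N * N))), le_max_left _ _, ?_⟩
  intro ν hν t ht
  let k : Fin N := ⟨0, by omega⟩
  obtain ⟨B, hB⟩ := Orthonormal.exists_orthonormalBasis_extension_of_card_eq (𝕜 := ℝ)
    (E := Euc N) (ι := Fin N) (by simp) (v := fun _ => ν) (s := {k}) (by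
      rw [orthonormal_iff_ite]
      rintro ⟨i, hi⟩ ⟨j, hj⟩
      have hi' : i = k := hi
      have hj' : j = k := hj
      subst hi' hj'
      simp [Set.domRestrict, hν])
  have hBk : B k = ν := hB k rfl
  have hsub : {x : Euc N | ‖x‖ = 1 ∧ |inner ℝ ν x| ≤ t} ⊆
      ⋃ j ∈ (Finset.univ : Finset (Fin N)), ⋃ s ∈ ({1, -1} : Finset ℝ),
        {x | ‖x‖ = 1 ∧ |inner ℝ (B k) x| ≤ t ∧ 1 / (2 * (N : ℝ)) ≤ s * inner ℝ (B j) x} := by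
    rintro x ⟨hx, hxt⟩
    have : ∃ j, 1 / (2 * (N : ℝ)) ≤ |inner ℝ (B j) x| := by
      by_contra! hcon
      have h1 := B.sum_sq_inner_right x
      have h2 : ∑ i, (inner ℝ (B i) x) ^ 2 ≤ ∑ i : Fin N, (1 / (2 * (N : ℝ))) ^ 2 := by
        refine Finset.sum_le_sum (fun i _ => ?_)
        rw [← sq_abs]
        have := (hcon i).le
        gcongr
      rw [h1, hx] at h2
      simp only [Finset.sum_const, Finset.card_univ, Fintype.card_fin, nsmul_eq_mul] at h2
      have h3 : (N : ℝ) * (1 / (2 * N)) ^ 2 = 1 / (4 * N) := by field_simp; norm_num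
      rw [h3, le_div_iff₀ (by positivity)] at h2
      linarith
    obtain ⟨j, hj⟩ := this
    simp only [Set.mem_iUnion, hBk]
    rcases le_abs.1 hj with h | h
    · exact ⟨j, Finset.mem_univ _, 1, by simp, hx, hxt, by simpa using h⟩
    · exact ⟨j, Finset.mem_univ _, -1, by simp, hx, hxt, by simpa using h⟩
  refine (measure_mono hsub).trans ((measure_biUnion_finset_le _ _).trans ?_)
  calc _ ≤ ∑ j : Fin N, ∑ s ∈ ({1, -1} : Finset ℝ), M * ENNReal.ofReal (2 ^ N * N * t) := by
        refine Finset.sum_le_sum (fun j _ => (measure_biUnion_finset_le _ _).trans ?_)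
        refine Finset.sum_le_sum (fun s hs => piece_bound N hN B k j s (by simpa using hs) t ht)
    _ = ENNReal.ofReal (N * 2 * (M.toReal * (2 ^ N * N)) * t) := by
        have : ({1, -1} : Finset ℝ).card = 2 := by
          rw [Finset.card_pair]; norm_num
        simp only [Finset.sum_const, this, Finset.card_univ, Fintype.card_fin, nsmul_eq_mul]
        nth_rewrite 1 [← ENNReal.ofReal_toReal hMt]
        rw [← ENNReal.ofReal_mul (by positivity)]
        rw [← ENNReal.ofReal_natCast, ← ENNReal.ofReal_natCast, ← ENNReal.ofReal_mul (by positivity),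
          ← ENNReal.ofReal_mul (by positivity)]
        congr 1; push_cast; ring
    _ ≤ _ := by
        refine ENNReal.ofReal_le_ofReal ?_
        gcongr
        exact le_max_right _ _

/-- Markov-type lower bound. -/
lemma integral_lower (N : ℕ) (p : ℝ) (hp : 1 ≤ p) (K : ℝ) (hK : 1 ≤ K)
    (hband : ∀ ν : Euc N, ‖ν‖ = 1 → ∀ t : ℝ, 0 < t →
      Hm N {x | ‖x‖ = 1 ∧ |inner ℝ ν x| ≤ t} ≤ ENNReal.ofReal (K * t))
    (E : Set (Euc N)) (hE : MeasurableSet E) (hES : E ⊆ sphere (0 : Euc N) 1)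
    (hpos : 0 < Hm N E) (hfin : Hm N E ≠ ⊤) (v : Euc N) (g : Euc N → ℝ)
    (hg : ∀ x, |inner ℝ v x| ^ p ≤ g x) (hgi : IntegrableOn g E (Hm N)) :
    (‖v‖ * ((Hm N E).toReal / (2 * K))) ^ p * ((Hm N E).toReal / 2) ≤ ∫ x in E, g x ∂(Hm N) := by
  set h := (Hm N E).toReal with hh
  have hh0 : 0 < h := ENNReal.toReal_pos hpos.ne' hfin
  have hg0 : ∀ x, 0 ≤ g x := fun x => (Real.rpow_nonneg (abs_nonneg _) _).trans (hg x)
  rcases eq_or_ne v 0 with rfl | hv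
  · rw [norm_zero, zero_mul, Real.zero_rpow (by linarith), zero_mul]
    exact integral_nonneg hg0
  have hv0 : 0 < ‖v‖ := norm_pos_iff.2 hv
  set t := h / (2 * K) with htdef
  have ht : 0 < t := by positivity
  have hm := mul_meas_ge_le_integral_of_nonneg (μ := (Hm N).restrict E)
    (Filter.Eventually.of_forall hg0) hgi ((‖v‖ * t) ^ p)
  refine le_trans ?_ hm
  refine mul_le_mul_of_nonneg_left ?_ (by positivity)
  have hsplit : E ⊆ (E ∩ {x | (‖v‖ * t) ^ p ≤ g x}) ∪
      {x | ‖x‖ = 1 ∧ |inner ℝ (‖v‖⁻¹ • v) x| ≤ t} := by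
    intro x hx
    by_cases hc : |inner ℝ (‖v‖⁻¹ • v) x| ≤ t
    · right; exact ⟨by simpa using hES hx, hc⟩
    · left
      refine ⟨hx, le_trans ?_ (hg x)⟩
      push Not at hc
      rw [real_inner_smul_left, abs_mul, abs_of_pos (inv_pos.2 hv0), ← div_eq_inv_mul,
        lt_div_iff₀ hv0] at hc
      exact Real.rpow_le_rpow (by positivity) (by linarith) (by linarith)
  have h1 := (measure_mono hsplit).trans (measure_union_le (μ := Hm N) _ _)
  have h2 := hband (‖v‖⁻¹ • v) (by rw [norm_smul]; simp [hv0.ne']) t ht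
  have h3 : K * t = h / 2 := by rw [htdef]; field_simp
  rw [h3] at h2
  have hne : Hm N (E ∩ {x | (‖v‖ * t) ^ p ≤ g x}) ≠ ⊤ :=
    ne_top_of_le_ne_top hfin (measure_mono inter_subset_left)
  have h4 := h1.trans (add_le_add le_rfl h2)
  have h5 := ENNReal.toReal_mono (ENNReal.add_ne_top.2 ⟨hne, ENNReal.ofReal_ne_top⟩) h4
  rw [ENNReal.toReal_add hne ENNReal.ofReal_ne_top, ENNReal.toReal_ofReal (by positivity)] at h5
  rw [measureReal_restrict_apply' hE, inter_comm, measureReal_def]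
  linarith

lemma exists_row (N : ℕ) (hN : 2 ≤ N) (A : Mat N) :
    ∃ v : Euc N, frobNorm A / N ≤ ‖v‖ ∧
      ∀ x : Euc N, |inner ℝ v x| ≤ vecNorm (A.mulVec (fun j => x j)) := by
  have hN2 : (2 : ℝ) ≤ N := by exact_mod_cast hN
  have : ∃ i : Fin N, frob A A / N ≤ ∑ j, A i j * A i j := by
    by_contra! hcon
    have : ∑ i : Fin N, ∑ j, A i j * A i j < ∑ i : Fin N, frob A A / N :=
      Finset.sum_lt_sum_of_nonempty ⟨⟨0, by omega⟩, Finset.mem_univ _⟩ (fun i _ => hcon i)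
    simp only [Finset.sum_const, Finset.card_univ, Fintype.card_fin, nsmul_eq_mul] at this
    rw [mul_div_cancel₀ _ (by positivity)] at this
    exact lt_irrefl _ this
  obtain ⟨i, hi⟩ := this
  refine ⟨WithLp.toLp 2 (A i), ?_, ?_⟩
  · rw [EuclideanSpace.norm_eq, frobNorm, div_le_iff₀ (by positivity)]
    have hf : 0 ≤ frob A A := Finset.sum_nonneg fun i _ => Finset.sum_nonneg fun j _ =>
      mul_self_nonneg _
    rw [Real.sqrt_le_left (by positivity), mul_pow, Real.sq_sqrt (by positivity)]
    rw [div_le_iff₀ (by positivity)] at hi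
    have e : ∑ j, ‖(WithLp.toLp 2 (A i) : Euc N) j‖ ^ 2 = ∑ j, A i j * A i j := by
      refine Finset.sum_congr rfl (fun j _ => ?_)
      simp [sq]
    rw [e]
    refine hi.trans (mul_le_mul_of_nonneg_left (by nlinarith) ?_)
    exact Finset.sum_nonneg fun j _ => mul_self_nonneg _
  · intro x
    have e : inner ℝ (WithLp.toLp 2 (A i) : Euc N) x = A.mulVec (fun j => x j) i := by
      simp [PiLp.inner_apply, Matrix.mulVec, dotProduct, mul_comm]
    rw [e, vecNorm]
    refine Real.abs_le_sqrt ?_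
    exact Finset.single_le_sum (f := fun i => (A.mulVec (fun j => x j) i) ^ 2)
      (fun _ _ => sq_nonneg _) (Finset.mem_univ i)

lemma integrable_aux (N : ℕ) (E : Set (Euc N)) (hE : MeasurableSet E)
    (hES : E ⊆ sphere (0 : Euc N) 1) (hfin : Hm N E ≠ ⊤) (g : Euc N → ℝ) (hg : Continuous g) :
    IntegrableOn g E (Hm N) := by
  obtain ⟨c, hc⟩ := (isCompact_sphere (0 : Euc N) 1).exists_bound_of_continuousOn hg.continuousOn
  refine IntegrableOn.of_bound hfin.lt_top hg.aestronglyMeasurable c ?_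
  exact (ae_restrict_iff' hE).2 (Filter.Eventually.of_forall fun x hx => hc x (hES hx))

/-- Lower bound for the average of a rigid-motion norm over a
subset of the unit sphere. -/
theorem sphere_average_rigid_lower_bound
    (N : ℕ) (hN : 2 ≤ N) (p : ℝ) (hp : 1 ≤ p) :
    ∃ C : ℝ, 1 ≤ C ∧
      ∀ E : Set (Euc N), MeasurableSet E → E ⊆ sphere (0 : Euc N) 1 →
        0 < Hm N E →
        ∀ (b : Euc N) (A : Mat N),
          C⁻¹ * ((‖b‖ ^ p + frobNorm A ^ p) * (Hm N E).toReal ^ p) ≤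
            ⨍ x in E, (|rInner b x| ^ p +
              vecNorm (A.mulVec (fun j => x j)) ^ p) ∂(Hm N) := by
  obtain ⟨K, hK, hband⟩ := band_bound N hN
  have hN2 : (2 : ℝ) ≤ N := by exact_mod_cast hN
  have hp0 : 0 ≤ p := by linarith
  have hQ : 1 ≤ (2 * K * N) ^ p := Real.one_le_rpow (by nlinarith) hp0
  refine ⟨2 * (2 * K * N) ^ p, by linarith, ?_⟩
  intro E hE hES hpos b A
  have hnn : ∀ x : Euc N, 0 ≤ vecNorm (A.mulVec (fun j => x j)) := fun x => Real.sqrt_nonneg _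
  by_cases hfin : Hm N E = ⊤
  · rw [hfin, ENNReal.toReal_top, Real.zero_rpow (by linarith), mul_zero, mul_zero]
    rw [setAverage_eq]
    refine smul_nonneg (by positivity) (integral_nonneg fun x => ?_)
    exact add_nonneg (Real.rpow_nonneg (abs_nonneg _) _) (Real.rpow_nonneg (hnn x) _)
  obtain ⟨v, hv, hvx⟩ := exists_row N hN A
  have hc1 : Continuous fun x : Euc N => |rInner b x| ^ p := by
    unfold rInner
    exact (continuous_const.inner continuous_id).abs.rpow_const (fun _ => Or.inr hp0)
  have hc2 : Continuous fun x : Euc N => vecNorm (A.mulVec (fun j => x j)) ^ p := by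
    refine Continuous.rpow_const ?_ (fun _ => Or.inr hp0)
    unfold vecNorm Matrix.mulVec dotProduct
    fun_prop
  have hi1 := integrable_aux N E hE hES hfin _ hc1
  have hi2 := integrable_aux N E hE hES hfin _ hc2
  have l1 := integral_lower N p hp K hK hband E hE hES hpos hfin b _ (fun x => le_rfl) hi1
  have l2 := integral_lower N p hp K hK hband E hE hES hpos hfin v _
    (fun x => Real.rpow_le_rpow (abs_nonneg _) (hvx x) hp0) hi2
  rw [setAverage_eq, integral_add hi1 hi2, measureReal_def, smul_eq_mul]
  set h := (Hm N E).toReal with hh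
  have hh0 : 0 < h := ENNReal.toReal_pos hpos.ne' hfin
  have hF : 0 ≤ frobNorm A := Real.sqrt_nonneg _
  rw [← div_eq_inv_mul, ← div_eq_inv_mul, le_div_iff₀ hh0, div_mul_eq_mul_div,
    div_le_iff₀ (by positivity)]
  set I1 := ∫ x in E, |rInner b x| ^ p ∂(Hm N)
  set I2 := ∫ x in E, vecNorm (A.mulVec (fun j => x j)) ^ p ∂(Hm N)
  have key : ∀ w a I : ℝ, 0 ≤ a → 0 ≤ w → a / N ≤ w → (w * (h / (2 * K))) ^ p * (h / 2) ≤ I →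
      a ^ p * h ^ p * h ≤ I * (2 * (2 * K * N) ^ p) := by
    intro w a I ha hw haw hI
    have hKN : 0 ≤ 2 * K * N := by positivity
    calc a ^ p * h ^ p * h = (a * h) ^ p * h := by rw [Real.mul_rpow ha hh0.le]
      _ ≤ (w * (h / (2 * K)) * (2 * K * N)) ^ p * h := by
          refine mul_le_mul_of_nonneg_right (Real.rpow_le_rpow (by positivity) ?_ hp0) hh0.le
          have : w * (h / (2 * K)) * (2 * K * N) = w * N * h := by field_simp
          rw [this]
          rw [div_le_iff₀ (by positivity)] at haw
          gcongr
      _ = (w * (h / (2 * K))) ^ p * (h / 2) * (2 * (2 * K * N) ^ p) := by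
          rw [Real.mul_rpow (by positivity) hKN]; ring
      _ ≤ _ := by gcongr
  have k1 := key ‖b‖ ‖b‖ I1 (norm_nonneg _) (norm_nonneg _)
    (div_le_self (norm_nonneg _) (by linarith)) l1
  have k2 := key ‖v‖ (frobNorm A) I2 hF (norm_nonneg _) hv l2
  linarith

end Griffith
end
end
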